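/- arXiv:2305.10685 — 12 statements merged into one kernel-verified Lean document; each statement's English description precedes it below -/
import Mathlib

section
/- Let q be a power of an odd prime, d ≥ 2, k ≥ 1, and let A be a nonempty subset of {(i,j) : 1 ≤ i < j ≤ k+1}. Let r ∈ F_q be a nonzero square. If E ⊆ F_q^d satisfies |E| ≥ 2k·q^{d/2} (as real numbers, equivalently |E|² ≥ 4k²·q^d), then there exist (x_1,…,x_{k+1}) ∈ E^{k+1} and (y_1,…,y_{k+1}) ∈ E^{k+1} such that ‖y_i − y_j‖ = r·‖x_i − x_j‖ for all (i,j) ∈ A, and x_i ≠ x_j, y_i ≠ y_j for all 1 ≤ i < j ≤ k+1. -/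
open Finset

/-- Some translate of the dilation by `s` maps at least `m` points of `E` into `E`, provided
`E` has at least `|F| ^ d * m` ordered pairs of points. -/
lemma exists_translate_card_le {F : Type*} [Field F] [Fintype F] [DecidableEq F] {d m : ℕ}
    (s : F) (E : Finset (Fin d → F)) (hE : Fintype.card F ^ d * m ≤ E.card * E.card) :
    ∃ b : Fin d → F, m ≤ (E.filter fun x => s • x + b ∈ E).card := by
  have hcard : (univ : Finset (Fin d → F)).card * m ≤ (E ×ˢ E).card := by
    simpa [card_product] using hE
  obtain ⟨b, -, hb⟩ := exists_le_card_fiber_of_mul_le_card_of_maps_to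
    (f := fun z : (Fin d → F) × (Fin d → F) => z.2 - s • z.1)
    (fun _ _ => mem_univ _) univ_nonempty hcard
  have hsnd {z : (Fin d → F) × (Fin d → F)} (hz : z.2 - s • z.1 = b) : z.2 = s • z.1 + b := by
    rw [← hz, add_sub_cancel]
  refine ⟨b, hb.trans (card_le_card_of_injOn Prod.fst ?_ ?_)⟩
  · intro z hz
    simp only [coe_filter, mem_product, Set.mem_ofPred_eq] at hz ⊢
    exact ⟨hz.1.1, hsnd hz.2 ▸ hz.1.2⟩
  · intro z hz w hw hzw
    simp only [coe_filter, mem_product, Set.mem_ofPred_eq] at hz hw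
    exact Prod.ext hzw (by rw [hsnd hz.2, hsnd hw.2, hzw])

/-- Let `q = p^n` be a power of an odd prime, `d ≥ 2`, `k ≥ 1`, and let `A` be a
nonempty subset of `{(i,j) : i < j}` in `Fin (k+1) × Fin (k+1)`. Let `r ∈ F_q` be a nonzero square.
If `E ⊆ F_q^d` satisfies `|E|² ≥ 4k²·q^d` (equivalently `|E| ≥ 2k·q^{d/2}`), then there exist
`(k+1)`-tuples `x, y` of points of `E` such that `‖y_i − y_j‖ = r·‖x_i − x_j‖` for `(i,j) ∈ A`
and `x_i ≠ x_j`, `y_i ≠ y_j` for all `i < j`. -/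
theorem stmt_0 (p n : ℕ) (hp : p.Prime) (hp2 : p ≠ 2) (hn : 0 < n)
    (F : Type) [Field F] [Fintype F] [DecidableEq F]
    (hq : Fintype.card F = p ^ n)
    (d k : ℕ) (hd : 2 ≤ d) (hk : 1 ≤ k)
    (A : Finset (Fin (k + 1) × Fin (k + 1))) (hA : A.Nonempty)
    (hAlt : ∀ ij ∈ A, ij.1 < ij.2)
    (r s : F) (hs : s ≠ 0) (hr : r = s ^ 2)
    (E : Finset (Fin d → F))
    (hE : (4 : ℝ) * (k : ℝ) ^ 2 * (Fintype.card F : ℝ) ^ d ≤ (E.card : ℝ) ^ 2) :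
    ∃ x y : Fin (k + 1) → (Fin d → F),
      (∀ i, x i ∈ E) ∧ (∀ i, y i ∈ E) ∧
      (∀ ij ∈ A, ∑ m, (y ij.1 m - y ij.2 m) ^ 2 = r * ∑ m, (x ij.1 m - x ij.2 m) ^ 2) ∧
      (∀ i j : Fin (k + 1), i < j → x i ≠ x j ∧ y i ≠ y j) := by
  have hE' : Fintype.card F ^ d * (k + 1) ≤ E.card * E.card := by
    have h : 4 * k ^ 2 * Fintype.card F ^ d ≤ E.card ^ 2 := by exact_mod_cast hE
    have hk' : k + 1 ≤ 4 * k ^ 2 := by nlinarith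
    calc Fintype.card F ^ d * (k + 1) ≤ Fintype.card F ^ d * (4 * k ^ 2) := by gcongr
      _ = 4 * k ^ 2 * Fintype.card F ^ d := mul_comm _ _
      _ ≤ E.card * E.card := by rwa [← sq]
  obtain ⟨b, hb⟩ := exists_translate_card_le s E hE'
  obtain ⟨T, hT, hTcard⟩ := exists_subset_card_eq hb
  let e := (T.equivFinOfCardEq hTcard).symm
  have hmem (i) := mem_filter.1 (hT (e i).2)
  have hne {i j : Fin (k + 1)} (hij : i < j) : (e i : Fin d → F) ≠ e j :=
    fun h => hij.ne (e.injective (Subtype.ext h))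
  refine ⟨fun i => e i, fun i => s • (e i : Fin d → F) + b, fun i => (hmem i).1,
    fun i => (hmem i).2, fun ij _ => ?_, fun i j hij => ⟨hne hij, fun h => ?_⟩⟩
  · rw [hr, mul_sum]
    refine sum_congr rfl fun m _ => ?_
    simp only [Pi.add_apply, Pi.smul_apply, smul_eq_mul]
    ring
  · exact hne hij (smul_right_injective _ hs (add_right_cancel h))
end

section
/- Let p be an odd prime, k ≥ 2, and let r ∈ F_p be a nonzero square. If E ⊆ F_p² satisfies |E| ≥ 2kp, then there exist (x_1,…,x_{k+1}) ∈ E^{k+1} and (y_1,…,y_{k+1}) ∈ E^{k+1} such that x_i ≠ x_j and y_i ≠ y_j whenever 1 ≤ i < j ≤ k+1, and ‖y_i − y_{i+1}‖ = r·‖x_i − x_{i+1}‖ for every i ∈ {1,…,k} (a pair of dilated k-paths). -/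
open Finset

/-- Dilated `k`-paths: if `p` is an odd prime, `k ≥ 2`, `r` a nonzero square in
`F_p`, and `E ⊆ F_p²` with `|E| ≥ 2kp`, then there are tuples `x, y` of pairwise distinct points
of `E` with `‖y_i − y_{i+1}‖ = r·‖x_i − x_{i+1}‖` for each of the `k` consecutive edges. -/
theorem stmt_1 (p : ℕ) (hp : p.Prime) (hp2 : p ≠ 2)
    (F : Type) [Field F] [Fintype F] [DecidableEq F] (hq : Fintype.card F = p)
    (k : ℕ) (hk : 2 ≤ k)
    (r s : F) (hs : s ≠ 0) (hr : r = s ^ 2)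
    (E : Finset (Fin 2 → F)) (hE : 2 * k * p ≤ E.card) :
    ∃ x y : Fin (k + 1) → (Fin 2 → F),
      (∀ i, x i ∈ E) ∧ (∀ i, y i ∈ E) ∧
      (∀ i j : Fin (k + 1), i < j → x i ≠ x j ∧ y i ≠ y j) ∧
      (∀ i : Fin k, ∑ m, (y i.succ m - y i.castSucc m) ^ 2
        = r * ∑ m, (x i.succ m - x i.castSucc m) ^ 2) := by
  have hp0 : 0 < p := hp.pos
  have hlt : (univ : Finset (Fin 2 → F)).card * k < (E ×ˢ E).card := by
    rw [card_product, card_univ, Fintype.card_fun, hq, Fintype.card_fin]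
    calc p ^ 2 * k < (2 * k * p) * (2 * k * p) := by
          have h1 : 0 < p ^ 2 * k := by positivity
          nlinarith
      _ ≤ E.card * E.card := Nat.mul_le_mul hE hE
  obtain ⟨z, -, hz⟩ := exists_lt_card_fiber_of_mul_lt_card_of_maps_to
    (f := fun q : (Fin 2 → F) × (Fin 2 → F) => q.2 - s • q.1)
    (fun _ _ => mem_univ _) hlt
  obtain ⟨T, hT, hTc⟩ := exists_subset_card_eq (Nat.succ_le_of_lt hz)
  let e := T.equivFinOfCardEq hTc
  have he (i : Fin (k + 1)) : ((e.symm i).1.1 ∈ E ∧ (e.symm i).1.2 ∈ E) ∧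
      (e.symm i).1.2 = z + s • (e.symm i).1.1 := by
    have h := hT (e.symm i).2
    rw [mem_filter, mem_product, sub_eq_iff_eq_add] at h
    exact h
  have hinj (i j : Fin (k + 1)) (h : (e.symm i).1.1 = (e.symm j).1.1) : i = j := by
    apply e.symm.injective
    apply Subtype.ext
    apply Prod.ext h
    rw [(he i).2, (he j).2, h]
  refine ⟨fun i => (e.symm i).1.1, fun i => (e.symm i).1.2, fun i => (he i).1.1,
    fun i => (he i).1.2, fun i j hij => ⟨fun h => hij.ne (hinj i j h), fun h => ?_⟩, fun i => ?_⟩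
  · refine hij.ne (hinj i j ?_)
    dsimp only at h
    rw [(he i).2, (he j).2] at h
    exact smul_right_injective _ hs (add_left_cancel h)
  · dsimp only
    rw [(he i.succ).2, (he i.castSucc).2, hr, mul_sum]
    refine sum_congr rfl fun m _ => ?_
    simp only [Pi.add_apply, Pi.smul_apply, smul_eq_mul]
    ring
end

section
/- Let p be an odd prime, k ≥ 3, and let r ∈ F_p be a nonzero square. If E ⊆ F_p² satisfies |E| ≥ 2kp, then there exist (x_1,…,x_k) ∈ E^k and (y_1,…,y_k) ∈ E^k such that x_i ≠ x_j and y_i ≠ y_j whenever 1 ≤ i < j ≤ k, ‖y_i − y_{i+1}‖ = r·‖x_i − x_{i+1}‖ for every i ∈ {1,…,k−1}, and ‖y_k − y_1‖ = r·‖x_k − x_1‖ (a pair of dilated k-cycles). -/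
open Finset

/-- For any set `E` of points there is a translation vector `t` such that the graph of the dilation
`v ↦ s • v + t` contains at least `n` points of `E × E`, as soon as `#V * n ≤ #E ^ 2`. -/
lemma exists_le_card_filter_sub_smul {F V : Type*} [Fintype V] [DecidableEq V] [AddCommGroup V]
    [SMul F V] (s : F) (E : Finset V) (n : ℕ) (h : Fintype.card V * n ≤ E.card * E.card) :
    ∃ t : V, n ≤ ((E ×ˢ E).filter fun z => z.2 - s • z.1 = t).card := by
  obtain ⟨t, -, ht⟩ := exists_le_card_fiber_of_mul_le_card_of_maps_to (s := E ×ˢ E)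
    (t := (univ : Finset V)) (f := fun z => z.2 - s • z.1) (n := n) (fun _ _ => mem_univ _)
    ⟨0, mem_univ _⟩ (by rwa [card_product, card_univ])
  exact ⟨t, ht⟩

/-- Dilated `k`-cycles: if `p` is an odd prime, `k ≥ 3`, `r` a nonzero square in
`F_p`, and `E ⊆ F_p²` with `|E| ≥ 2kp`, then there are tuples `x, y : Fin k → F_p²` of pairwise
distinct points of `E` with `‖y_{i+1} − y_i‖ = r·‖x_{i+1} − x_i‖` for every `i : Fin k`
(addition taken cyclically in `Fin k`, so this includes the closing edge of the cycle). -/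
theorem stmt_2 (p : ℕ) (hp : p.Prime) (hp2 : p ≠ 2)
    (F : Type) [Field F] [Fintype F] [DecidableEq F] (hq : Fintype.card F = p)
    (k : ℕ) (hk : 3 ≤ k) [NeZero k]
    (r s : F) (hs : s ≠ 0) (hr : r = s ^ 2)
    (E : Finset (Fin 2 → F)) (hE : 2 * k * p ≤ E.card) :
    ∃ x y : Fin k → (Fin 2 → F),
      (∀ i, x i ∈ E) ∧ (∀ i, y i ∈ E) ∧
      (∀ i j : Fin k, i < j → x i ≠ x j ∧ y i ≠ y j) ∧
      (∀ i : Fin k, ∑ m, (y (i + 1) m - y i m) ^ 2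
        = r * ∑ m, (x (i + 1) m - x i m) ^ 2) := by
  have hcard : Fintype.card (Fin 2 → F) * k ≤ E.card * E.card := by
    have h : 2 * k * p * (2 * k * p) ≤ E.card * E.card := Nat.mul_le_mul hE hE
    simp only [Fintype.card_fun, Fintype.card_fin, hq]
    calc p ^ 2 * k ≤ p ^ 2 * (4 * k * k) := Nat.mul_le_mul_left _ (by nlinarith)
      _ = 2 * k * p * (2 * k * p) := by ring
      _ ≤ _ := h
  obtain ⟨t, ht⟩ := exists_le_card_filter_sub_smul s E k hcard
  obtain ⟨S, hS, hSk⟩ := exists_subset_card_eq ht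
  let e := (S.equivFinOfCardEq hSk).symm
  have hmem (i : Fin k) : ((e i).1.1 ∈ E ∧ (e i).1.2 ∈ E) ∧ (e i).1.2 - s • (e i).1.1 = t := by
    simpa only [mem_filter, mem_product] using hS (e i).2
  have hy (i : Fin k) : (e i).1.2 = s • (e i).1.1 + t := by
    rw [← (hmem i).2, add_sub_cancel]
  have hinj (i j : Fin k) (h : (e i).1.1 = (e j).1.1) : i = j :=
    e.injective (Subtype.ext (Prod.ext h (by rw [hy, hy, h])))
  refine ⟨fun i => (e i).1.1, fun i => (e i).1.2, fun i => (hmem i).1.1, fun i => (hmem i).1.2,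
    fun i j hij => ⟨fun h => hij.ne (hinj i j h), fun h => hij.ne (hinj i j ?_)⟩, fun i => ?_⟩
  · simp only [hy] at h
    exact smul_right_injective _ hs (add_right_cancel h)
  · simp only [hy, Pi.add_apply, Pi.smul_apply, smul_eq_mul, hr, mul_sum]
    exact sum_congr rfl fun m _ => by ring
end

section
/- Let p be an odd prime, k ≥ 1, and let r ∈ F_p be a nonzero square. If E ⊆ F_p² satisfies |E| ≥ 2kp, then there exist (x_1,…,x_{k+1}) ∈ E^{k+1} and (y_1,…,y_{k+1}) ∈ E^{k+1} such that x_i ≠ x_j and y_i ≠ y_j whenever 1 ≤ i < j ≤ k+1, and ‖y_1 − y_i‖ = r·‖x_1 − x_i‖ for every i ∈ {2,…,k+1} (a pair of dilated k-stars). -/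
open Finset

/-- Dilated `k`-stars: if `p` is an odd prime, `k ≥ 1`, `r` a nonzero square in
`F_p`, and `E ⊆ F_p²` with `|E| ≥ 2kp`, then there are tuples `x, y : Fin (k+1) → F_p²` of
pairwise distinct points of `E` with `‖y_0 − y_i‖ = r·‖x_0 − x_i‖` for every `i ≠ 0`. -/
theorem stmt_3 (p : ℕ) (hp : p.Prime) (hp2 : p ≠ 2)
    (F : Type) [Field F] [Fintype F] [DecidableEq F] (hq : Fintype.card F = p)
    (k : ℕ) (hk : 1 ≤ k)
    (r s : F) (hs : s ≠ 0) (hr : r = s ^ 2)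
    (E : Finset (Fin 2 → F)) (hE : 2 * k * p ≤ E.card) :
    ∃ x y : Fin (k + 1) → (Fin 2 → F),
      (∀ i, x i ∈ E) ∧ (∀ i, y i ∈ E) ∧
      (∀ i j : Fin (k + 1), i < j → x i ≠ x j ∧ y i ≠ y j) ∧
      (∀ i : Fin (k + 1), i ≠ 0 → ∑ m, (y 0 m - y i m) ^ 2
        = r * ∑ m, (x 0 m - x i m) ^ 2) := by
  have hcard : (univ : Finset (Fin 2 → F)).card * k < (E ×ˢ E).card := by
    rw [card_product, card_univ, Fintype.card_fun, hq, Fintype.card_fin]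
    have hp0 : 0 < p := hp.pos
    calc p ^ 2 * k < (2 * k * p) * (2 * k * p) := by
          have h : k < 4 * k ^ 2 := by nlinarith
          have h' := Nat.mul_lt_mul_of_pos_left h (pow_pos hp0 2)
          linarith
      _ ≤ E.card * E.card := Nat.mul_le_mul hE hE
  obtain ⟨z, -, hz⟩ := exists_lt_card_fiber_of_mul_lt_card_of_maps_to
    (f := fun q : (Fin 2 → F) × (Fin 2 → F) => q.2 - s • q.1)
    (fun _ _ => mem_univ _) hcard
  obtain ⟨A, hA, hAk⟩ := exists_subset_card_eq (Nat.succ_le_of_lt hz)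
  let e := A.equivFinOfCardEq hAk
  have he (i : Fin (k + 1)) : ((e.symm i).1.1 ∈ E ∧ (e.symm i).1.2 ∈ E) ∧
      (e.symm i).1.2 - s • (e.symm i).1.1 = z := by
    have h := hA (e.symm i).2
    rwa [mem_filter, mem_product] at h
  have hy (i : Fin (k + 1)) : (e.symm i).1.2 = z + s • (e.symm i).1.1 :=
    sub_eq_iff_eq_add.mp (he i).2
  refine ⟨fun i => (e.symm i).1.1, fun i => (e.symm i).1.2, fun i => (he i).1.1,
    fun i => (he i).1.2, fun i j hij => ?_, fun i _ => ?_⟩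
  · have hx : (e.symm i).1.1 ≠ (e.symm j).1.1 := fun h =>
      hij.ne (e.symm.injective (Subtype.ext (Prod.ext h (by rw [hy i, hy j, h]))))
    refine ⟨hx, fun h => hx ?_⟩
    dsimp only at h
    rw [hy i, hy j] at h
    exact smul_right_injective _ hs (add_left_cancel h)
  · simp only [hy, hr, mul_sum, Pi.add_apply, Pi.smul_apply, smul_eq_mul]
    exact sum_congr rfl fun m _ => by ring
end

section
/- Let q be a power of an odd prime, d ≥ 1, k ≥ 1, E ⊆ F_q^d a finite set, and s ∈ F_q with s ≠ 0. For θ ∈ O_d(F_q), let N_θ denote the set of tuples (u_1,…,u_{k+1},v_1,…,v_{k+1}) ∈ E^{2k+2} such that u_i − u_j = s·θ(v_i − v_j) and v_i ≠ v_j for all 1 ≤ i < j ≤ k+1. Then ∑_{θ ∈ O_d(F_q)} |N_θ| ≥ ∑_{θ ∈ O_d(F_q)} ∑_{z ∈ F_q^d} λ_{s,θ}(z)^{k+1} − (k(k+1)/2) · ∑_{θ ∈ O_d(F_q)} ∑_{z ∈ F_q^d} λ_{s,θ}(z)^k. -/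
open Finset

/-- The finite set of `d × d` orthogonal matrices over `F` (those with `θ * θᵀ = 1`). -/
def orthGroup (F : Type) [Field F] [Fintype F] [DecidableEq F] (d : ℕ) :
    Finset (Matrix (Fin d) (Fin d) F) :=
  Finset.univ.filter fun θ => θ * θ.transpose = 1

/-- The counting function `λ_{s,θ}(z) = #{(u,v) ∈ E × E : u − s·θv = z}`. -/
def lamCount {F : Type} [Field F] [Fintype F] [DecidableEq F] {d : ℕ}
    (E : Finset (Fin d → F)) (s : F) (θ : Matrix (Fin d) (Fin d) F) (z : Fin d → F) : ℕ :=
  ((E ×ˢ E).filter fun uv => uv.1 - s • θ.mulVec uv.2 = z).card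

/-- The set `N_θ` of tuples `(u₁,…,u_{k+1},v₁,…,v_{k+1}) ∈ E^{2k+2}` with
`u_i − u_j = s·θ(v_i − v_j)` and `v_i ≠ v_j` for all `i < j`. -/
def NSet {F : Type} [Field F] [Fintype F] [DecidableEq F] {d : ℕ} (k : ℕ)
    (E : Finset (Fin d → F)) (s : F) (θ : Matrix (Fin d) (Fin d) F) :
    Finset ((Fin (k + 1) → Fin d → F) × (Fin (k + 1) → Fin d → F)) :=
  Finset.univ.filter fun uv =>
    (∀ i, uv.1 i ∈ E) ∧ (∀ i, uv.2 i ∈ E) ∧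
      ∀ i j : Fin (k + 1), i < j →
        uv.1 i - uv.1 j = s • θ.mulVec (uv.2 i - uv.2 j) ∧ uv.2 i ≠ uv.2 j

/-- The falling factorial `x(x-1)⋯(x-k)` is at least `x^(k+1) - (k(k+1)/2) x^k`. -/
theorem pow_sub_mul_pow_le_descFactorial (x k : ℕ) :
    (x : ℝ) ^ (k + 1) - ((k : ℝ) * (k + 1) / 2) * (x : ℝ) ^ k ≤ (x.descFactorial (k + 1) : ℝ) := by
  induction k with
  | zero => simp
  | succ k ih =>
    have hpow : (x.descFactorial (k + 1) : ℝ) ≤ (x : ℝ) ^ (k + 1) := by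
      exact_mod_cast Nat.descFactorial_le_pow x (k + 1)
    have hsub : (x : ℝ) - (k + 1) ≤ ((x - (k + 1) : ℕ) : ℝ) := by
      have h : x ≤ (x - (k + 1)) + (k + 1) := by omega
      have h' : (x : ℝ) ≤ ((x - (k + 1) : ℕ) : ℝ) + (k + 1) := by exact_mod_cast h
      linarith
    have hmul := mul_le_mul_of_nonneg_right hsub (Nat.cast_nonneg' (x.descFactorial (k + 1)))
    have hx := mul_le_mul_of_nonneg_left ih (Nat.cast_nonneg' x : (0 : ℝ) ≤ x)
    have hk := mul_le_mul_of_nonneg_left hpow (by positivity : (0 : ℝ) ≤ (k : ℝ) + 1)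
    rw [Nat.descFactorial_succ x (k + 1)]
    push_cast
    calc _ = (x : ℝ) * ((x : ℝ) ^ (k + 1) - ((k : ℝ) * (k + 1) / 2) * (x : ℝ) ^ k)
          - ((k : ℝ) + 1) * (x : ℝ) ^ (k + 1) := by ring
      _ ≤ ((x : ℝ) - (k + 1)) * (x.descFactorial (k + 1) : ℝ) := by linarith
      _ ≤ _ := hmul

/-- Injective `(k+1)`-tuples of pairs in a common fibre of `(u, v) ↦ u - s • θ v` give elements
of `NSet`. -/
theorem sum_descFactorial_lamCount_le_card_NSet {F : Type} [Field F] [Fintype F] [DecidableEq F]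
    {d : ℕ} (k : ℕ) (E : Finset (Fin d → F)) (s : F) (θ : Matrix (Fin d) (Fin d) F) :
    ∑ z : Fin d → F, (lamCount E s θ z).descFactorial (k + 1) ≤ (NSet k E s θ).card := by
  let S : (Fin d → F) → Finset ((Fin d → F) × (Fin d → F)) := fun z =>
    (E ×ˢ E).filter fun uv => uv.1 - s • θ.mulVec uv.2 = z
  have hS : ∀ z (w : S z), (w.1.1 ∈ E ∧ w.1.2 ∈ E) ∧ w.1.1 - s • θ.mulVec w.1.2 = z :=
    fun z w => by simpa only [S, Finset.mem_filter, Finset.mem_product] using w.2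
  have hcard : ∑ z : Fin d → F, (lamCount E s θ z).descFactorial (k + 1)
      = Fintype.card (Σ z : Fin d → F, Fin (k + 1) ↪ S z) := by
    simp only [Fintype.card_sigma, Fintype.card_embedding_eq, Fintype.card_coe, Fintype.card_fin,
      lamCount, S]
  rw [hcard, ← Finset.card_univ]
  refine Finset.card_le_card_of_injOn
    (fun f => (fun i => (f.2 i).1.1, fun i => (f.2 i).1.2)) ?_ ?_
  · rintro ⟨z, f⟩ -
    simp only [NSet, Finset.coe_filter, Finset.mem_univ, true_and, Set.mem_ofPred_eq]
    refine ⟨fun i => (hS z (f i)).1.1, fun i => (hS z (f i)).1.2, fun i j hij => ?_⟩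
    have hi := sub_eq_iff_eq_add.mp (hS z (f i)).2
    have hj := sub_eq_iff_eq_add.mp (hS z (f j)).2
    refine ⟨?_, fun hv => hij.ne (f.injective (Subtype.ext (Prod.ext ?_ hv)))⟩
    · rw [hi, hj, Matrix.mulVec_sub, smul_sub, add_sub_add_left_eq_sub]
    · rw [hi, hj, hv]
  · rintro ⟨z, f⟩ - ⟨z', g⟩ - h
    have hfg : ∀ i, (f i).1 = (g i).1 := fun i =>
      Prod.ext (congrFun (congrArg Prod.fst h) i) (congrFun (congrArg Prod.snd h) i)
    obtain rfl : z = z' := by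
      rw [← (hS z (f 0)).2, ← (hS z' (g 0)).2, hfg 0]
    obtain rfl : f = g := DFunLike.ext _ _ fun i => Subtype.ext (hfg i)
    rfl

/-- `∑_θ |N_θ| ≥ ∑_θ ∑_z λ_{s,θ}(z)^{k+1} − (k(k+1)/2)·∑_θ ∑_z λ_{s,θ}(z)^k`. -/
theorem stmt_7 (p n : ℕ) (hp : p.Prime) (hp2 : p ≠ 2) (hn : 0 < n)
    (F : Type) [Field F] [Fintype F] [DecidableEq F] (hq : Fintype.card F = p ^ n)
    (d k : ℕ) (hd : 1 ≤ d) (hk : 1 ≤ k)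
    (E : Finset (Fin d → F)) (s : F) (hs : s ≠ 0) :
    (∑ θ ∈ orthGroup F d, ∑ z : Fin d → F, (lamCount E s θ z : ℝ) ^ (k + 1))
      - ((k : ℝ) * (k + 1) / 2) *
        ∑ θ ∈ orthGroup F d, ∑ z : Fin d → F, (lamCount E s θ z : ℝ) ^ k
      ≤ ∑ θ ∈ orthGroup F d, ((NSet k E s θ).card : ℝ) := by
  rw [Finset.mul_sum, ← Finset.sum_sub_distrib]
  refine Finset.sum_le_sum fun θ _ => ?_
  rw [Finset.mul_sum, ← Finset.sum_sub_distrib]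
  calc _ ≤ ∑ z : Fin d → F, ((lamCount E s θ z).descFactorial (k + 1) : ℝ) :=
        Finset.sum_le_sum fun z _ => pow_sub_mul_pow_le_descFactorial _ k
    _ ≤ _ := by exact_mod_cast sum_descFactorial_lamCount_le_card_NSet k E s θ
end

section
/- Let q be a power of an odd prime, d ≥ 1, k ≥ 1, E ⊆ F_q^d a finite set, r ∈ F_q a nonzero square with r = s², s ≠ 0, and let A ⊆ {(i,j) : 1 ≤ i < j ≤ k+1}. Let S_A denote the set of tuples (x_1,…,x_{k+1},y_1,…,y_{k+1}) ∈ E^{2k+2} such that ‖y_i − y_j‖ = r·‖x_i − x_j‖ for all (i,j) ∈ A, and x_i ≠ x_j, y_i ≠ y_j for all 1 ≤ i < j ≤ k+1. Then |S_A| ≥ (1/|O_d(F_q)|) · ( ∑_{θ ∈ O_d(F_q)} ∑_{z ∈ F_q^d} λ_{s,θ}(z)^{k+1} − (k(k+1)/2) · ∑_{θ ∈ O_d(F_q)} ∑_{z ∈ F_q^d} λ_{s,θ}(z)^k ). -/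
open Finset

/-- The set `S_A` of tuples `(x₁,…,x_{k+1},y₁,…,y_{k+1}) ∈ E^{2k+2}` with
`‖y_i − y_j‖ = r·‖x_i − x_j‖` for all `(i,j) ∈ A`, and `x_i ≠ x_j`, `y_i ≠ y_j` for all
`i < j`. -/
def SAset {F : Type} [Field F] [Fintype F] [DecidableEq F] {d : ℕ} (k : ℕ)
    (E : Finset (Fin d → F)) (r : F) (A : Finset (Fin (k + 1) × Fin (k + 1))) :
    Finset ((Fin (k + 1) → Fin d → F) × (Fin (k + 1) → Fin d → F)) :=
  Finset.univ.filter fun xy =>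
    (∀ i, xy.1 i ∈ E) ∧ (∀ i, xy.2 i ∈ E) ∧
      (∀ ij ∈ A, ∑ m, (xy.2 ij.1 m - xy.2 ij.2 m) ^ 2
        = r * ∑ m, (xy.1 ij.1 m - xy.1 ij.2 m) ^ 2) ∧
      ∀ i j : Fin (k + 1), i < j → xy.1 i ≠ xy.1 j ∧ xy.2 i ≠ xy.2 j

lemma pow_succ_le_descFactorial_add (n k : ℕ) :
    (n : ℝ) ^ (k + 1) ≤ n.descFactorial (k + 1) + (k : ℝ) * (k + 1) / 2 * (n : ℝ) ^ k := by
  induction k with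
  | zero => simp
  | succ k ih =>
    have hD : (n.descFactorial (k + 2) : ℝ)
        = ((n : ℝ) - (k + 1)) * n.descFactorial (k + 1) := by
      rw [Nat.descFactorial_succ n (k + 1)]
      rcases lt_or_ge n (k + 1) with h | h
      · rw [Nat.descFactorial_of_lt h]
        simp
      · push_cast [Nat.cast_sub h]
        ring
    have hle : (n.descFactorial (k + 1) : ℝ) ≤ (n : ℝ) ^ (k + 1) := by
      exact_mod_cast Nat.descFactorial_le_pow n (k + 1)
    have h1 : (n : ℝ) * n ^ (k + 1) ≤
        n * n.descFactorial (k + 1) + (k : ℝ) * (k + 1) / 2 * n ^ (k + 1) :=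
      (mul_le_mul_of_nonneg_left ih (Nat.cast_nonneg n)).trans_eq (by ring)
    have h2 : ((k : ℝ) + 1) * n.descFactorial (k + 1) ≤ (k + 1) * (n : ℝ) ^ (k + 1) :=
      mul_le_mul_of_nonneg_left hle (by positivity)
    rw [hD, pow_succ' (n : ℝ) (k + 1)]
    push_cast
    linarith

section Orthogonal

variable {F : Type} [Field F] {d : ℕ}

lemma sum_sq_smul_mulVec {θ : Matrix (Fin d) (Fin d) F} (hθ : θ * θ.transpose = 1)
    (s : F) (w : Fin d → F) :
    ∑ m, (s • θ.mulVec w) m ^ 2 = s ^ 2 * ∑ m, w m ^ 2 := by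
  have hθ' : θ.transpose * θ = 1 := mul_eq_one_comm.mp hθ
  have h : θ.mulVec w ⬝ᵥ θ.mulVec w = w ⬝ᵥ w := by
    rw [Matrix.dotProduct_mulVec, ← Matrix.mulVec_transpose, Matrix.mulVec_mulVec, hθ',
      Matrix.one_mulVec]
  simp only [dotProduct, ← sq] at h
  simp only [Pi.smul_apply, smul_eq_mul, mul_pow, ← Finset.mul_sum, h]

lemma smul_mulVec_eq_zero {θ : Matrix (Fin d) (Fin d) F} (hθ : θ * θ.transpose = 1)
    {s : F} (hs : s ≠ 0) {w : Fin d → F} (h : s • θ.mulVec w = 0) : w = 0 := by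
  have hθ' : θ.transpose * θ = 1 := mul_eq_one_comm.mp hθ
  have h0 : θ.mulVec w = 0 := (smul_eq_zero.mp h).resolve_left hs
  rw [← Matrix.one_mulVec w, ← hθ', ← Matrix.mulVec_mulVec, h0, Matrix.mulVec_zero]

variable [Fintype F] [DecidableEq F]

/-- Injective `(k+1)`-tuples of pairs counted by `λ_{s,θ}(z)` give elements of `S_A`. -/
lemma descFactorial_lamCount_le (k : ℕ) (E : Finset (Fin d → F)) {s : F} (hs : s ≠ 0)
    (A : Finset (Fin (k + 1) × Fin (k + 1)))
    {θ : Matrix (Fin d) (Fin d) F} (hθ : θ * θ.transpose = 1) (z : Fin d → F) :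
    (lamCount E s θ z).descFactorial (k + 1) ≤
      #{xy ∈ SAset k E (s ^ 2) A | xy.2 0 - s • θ.mulVec (xy.1 0) = z} := by
  set P := (E ×ˢ E).filter fun uv => uv.1 - s • θ.mulVec uv.2 = z
  have hcard : (lamCount E s θ z).descFactorial (k + 1)
      = #(univ : Finset (Fin (k + 1) ↪ P)) := by
    rw [Finset.card_univ, Fintype.card_embedding_eq, Fintype.card_fin, Fintype.card_coe]
    rfl
  rw [hcard]
  refine Finset.card_le_card_of_injOn
    (fun f => (fun i => (f i).1.2, fun i => (f i).1.1)) ?_ ?_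
  · intro f _
    have hmem (i) : ((f i).1.1 ∈ E ∧ (f i).1.2 ∈ E) ∧
        (f i).1.1 - s • θ.mulVec (f i).1.2 = z := by
      obtain ⟨h1, h2⟩ := mem_filter.mp (f i).2
      exact ⟨mem_product.mp h1, h2⟩
    have hdiff (i j) : (f i).1.1 - (f j).1.1 = s • θ.mulVec ((f i).1.2 - (f j).1.2) := by
      rw [Matrix.mulVec_sub, smul_sub, sub_eq_sub_iff_sub_eq_sub, (hmem i).2, (hmem j).2]
    have hsnd (i j) (hij : i ≠ j) : (f i).1.2 ≠ (f j).1.2 := fun h => by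
      have h1 := hdiff i j
      rw [h, sub_self, Matrix.mulVec_zero, smul_zero, sub_eq_zero] at h1
      exact hij (f.injective (Subtype.ext (Prod.ext h1 h)))
    have hfst (i j) (hij : i ≠ j) : (f i).1.1 ≠ (f j).1.1 := fun h => by
      have h1 := hdiff i j
      rw [h, sub_self] at h1
      exact hsnd i j hij (sub_eq_zero.mp (smul_mulVec_eq_zero hθ hs h1.symm))
    simp only [SAset, coe_filter, mem_filter, mem_univ, true_and, Set.mem_ofPred_eq]
    refine ⟨⟨fun i => (hmem i).1.2, fun i => (hmem i).1.1, fun ij _ => ?_,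
      fun i j hij => ⟨hsnd i j hij.ne, hfst i j hij.ne⟩⟩, (hmem 0).2⟩
    have h := sum_sq_smul_mulVec hθ s ((f ij.1).1.2 - (f ij.2).1.2)
    rw [← hdiff] at h
    simpa using h
  · intro f _ g _ hfg
    simp only [Prod.mk.injEq] at hfg
    ext1 i
    exact Subtype.ext (Prod.ext (congrFun hfg.2 i) (congrFun hfg.1 i))

lemma sum_lamCount_pow_le (k : ℕ) (E : Finset (Fin d → F)) {s : F} (hs : s ≠ 0)
    (A : Finset (Fin (k + 1) × Fin (k + 1)))
    {θ : Matrix (Fin d) (Fin d) F} (hθ : θ * θ.transpose = 1) :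
    ∑ z : Fin d → F, (lamCount E s θ z : ℝ) ^ (k + 1) ≤ #(SAset k E (s ^ 2) A)
      + (k : ℝ) * (k + 1) / 2 * ∑ z : Fin d → F, (lamCount E s θ z : ℝ) ^ k := by
  rw [Finset.card_eq_sum_card_fiberwise (t := univ)
    (f := fun xy => xy.2 0 - s • θ.mulVec (xy.1 0)) (fun _ _ => by simp),
    Finset.mul_sum, Nat.cast_sum, ← Finset.sum_add_distrib]
  refine Finset.sum_le_sum fun z _ => (pow_succ_le_descFactorial_add _ k).trans ?_
  gcongr
  exact descFactorial_lamCount_le k E hs A hθ z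

end Orthogonal

/-- With `r = s²`, `s ≠ 0`, one has
`|S_A| ≥ (1/|O_d(F_q)|)·(∑_θ ∑_z λ_{s,θ}(z)^{k+1} − (k(k+1)/2)·∑_θ ∑_z λ_{s,θ}(z)^k)`. -/
theorem stmt_8 (p n : ℕ) (hp : p.Prime) (hp2 : p ≠ 2) (hn : 0 < n)
    (F : Type) [Field F] [Fintype F] [DecidableEq F] (hq : Fintype.card F = p ^ n)
    (d k : ℕ) (hd : 1 ≤ d) (hk : 1 ≤ k)
    (E : Finset (Fin d → F)) (r s : F) (hs : s ≠ 0) (hr : r = s ^ 2)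
    (A : Finset (Fin (k + 1) × Fin (k + 1))) (hAlt : ∀ ij ∈ A, ij.1 < ij.2) :
    (1 / ((orthGroup F d).card : ℝ)) *
        ((∑ θ ∈ orthGroup F d, ∑ z : Fin d → F, (lamCount E s θ z : ℝ) ^ (k + 1))
          - ((k : ℝ) * (k + 1) / 2) *
            ∑ θ ∈ orthGroup F d, ∑ z : Fin d → F, (lamCount E s θ z : ℝ) ^ k)
      ≤ ((SAset k E r A).card : ℝ) := by
  subst hr
  have hsum := Finset.sum_le_sum fun θ (hθ : θ ∈ orthGroup F d) =>
    sum_lamCount_pow_le k E hs A (Finset.mem_filter.mp hθ).2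
  rw [Finset.sum_add_distrib, ← Finset.mul_sum, Finset.sum_const, nsmul_eq_mul] at hsum
  have hpos : (0 : ℝ) < #(orthGroup F d) := by
    exact_mod_cast Finset.card_pos.mpr ⟨1, by simp [orthGroup]⟩
  rw [one_div_mul_eq_div, div_le_iff₀ hpos]
  linarith
end

section
/- Let q be a power of an odd prime, d ≥ 1, k ≥ 1, E ⊆ F_q^d a finite set, r ∈ F_q a nonzero square, and let A ⊆ {(i,j) : 1 ≤ i < j ≤ k+1}. Let S_A denote the set of tuples (x_1,…,x_{k+1},y_1,…,y_{k+1}) ∈ E^{2k+2} such that ‖y_i − y_j‖ = r·‖x_i − x_j‖ for all (i,j) ∈ A, and x_i ≠ x_j, y_i ≠ y_j for all 1 ≤ i < j ≤ k+1. Then, as real numbers, |S_A| ≥ |E|^{2k+2} / (2·q^{dk}) − (k² + k)^{k+1} · q^d / 2. -/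
open Finset

theorem two_mul_pow_succ_le_descFactorial_add (N j : ℕ) :
    2 * N ^ (j + 1) ≤ 2 * N.descFactorial (j + 1) + j * (j + 1) * N ^ j := by
  induction j with
  | zero => simp
  | succ j ih =>
    rw [Nat.descFactorial_succ N (j + 1)]
    have h1 : N.descFactorial (j + 1) ≤ N ^ (j + 1) := Nat.descFactorial_le_pow N (j + 1)
    have h2 : N ≤ (N - (j + 1)) + (j + 1) := by omega
    calc 2 * N ^ (j + 1 + 1) = N * (2 * N ^ (j + 1)) := by ring
      _ ≤ N * (2 * N.descFactorial (j + 1) + j * (j + 1) * N ^ j) := by gcongr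
      _ = 2 * (N * N.descFactorial (j + 1)) + j * (j + 1) * N ^ (j + 1) := by ring
      _ ≤ 2 * (((N - (j + 1)) + (j + 1)) * N.descFactorial (j + 1))
          + j * (j + 1) * N ^ (j + 1) := by gcongr
      _ = 2 * ((N - (j + 1)) * N.descFactorial (j + 1))
          + (2 * (j + 1) * N.descFactorial (j + 1) + j * (j + 1) * N ^ (j + 1)) := by ring
      _ ≤ 2 * ((N - (j + 1)) * N.descFactorial (j + 1))
          + (2 * (j + 1) * N ^ (j + 1) + j * (j + 1) * N ^ (j + 1)) := by gcongr
      _ = 2 * ((N - (j + 1)) * N.descFactorial (j + 1))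
          + (j + 1) * (j + 1 + 1) * N ^ (j + 1) := by ring

theorem pow_succ_le_two_mul_descFactorial_add (N k : ℕ) :
    N ^ (k + 1) ≤ 2 * N.descFactorial (k + 1) + (k ^ 2 + k) ^ (k + 1) := by
  rcases le_total N (k ^ 2 + k) with h | h
  · exact (Nat.pow_le_pow_left h _).trans (Nat.le_add_left _ _)
  · have h1 := two_mul_pow_succ_le_descFactorial_add N k
    have h2 : k * (k + 1) * N ^ k ≤ N ^ (k + 1) := by
      calc k * (k + 1) * N ^ k = (k ^ 2 + k) * N ^ k := by ring
        _ ≤ N * N ^ k := by gcongr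
        _ = N ^ (k + 1) := by ring
    omega

section

variable {F : Type} [Field F] [Fintype F] [DecidableEq F] {d : ℕ}

/-- The points of `E` sent into `E` by the similarity `x ↦ s • x + z`. -/
def similarityFiber (E : Finset (Fin d → F)) (s : F) (z : Fin d → F) : Finset (Fin d → F) :=
  E.filter fun x => s • x + z ∈ E

theorem sum_card_similarityFiber (E : Finset (Fin d → F)) (s : F) :
    ∑ z, (similarityFiber E s z).card = E.card ^ 2 := by
  simp only [similarityFiber, Finset.card_filter]
  rw [Finset.sum_comm]
  have h (x : Fin d → F) : ∑ z, (if s • x + z ∈ E then 1 else 0) = E.card := by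
    refine (Equiv.sum_comp (Equiv.addLeft (s • x)) fun z => if z ∈ E then 1 else 0).trans ?_
    simp
  simp [h, sq]

theorem sum_descFactorial_le_card_SAset (k : ℕ) (E : Finset (Fin d → F)) {s : F} (hs : s ≠ 0)
    (A : Finset (Fin (k + 1) × Fin (k + 1))) :
    ∑ z, (similarityFiber E s z).card.descFactorial (k + 1) ≤ (SAset k E (s ^ 2) A).card := by
  have hcard : ∑ z, (similarityFiber E s z).card.descFactorial (k + 1)
      = (Finset.univ : Finset (Σ z, Fin (k + 1) ↪ similarityFiber E s z)).card := by
    simp [Finset.card_univ, Fintype.card_sigma, Fintype.card_embedding_eq]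
  rw [hcard]
  refine Finset.card_le_card_of_injOn
    (fun w => (fun i => (w.2 i : Fin d → F), fun i => s • (w.2 i : Fin d → F) + w.1)) ?_ ?_
  · rintro ⟨z, f⟩ -
    have hf (i) : (f i : Fin d → F) ∈ E ∧ s • (f i : Fin d → F) + z ∈ E :=
      Finset.mem_filter.1 (f i).2
    simp only [SAset, Finset.coe_filter, Set.mem_ofPred_eq, Finset.mem_univ, true_and]
    refine ⟨fun i => (hf i).1, fun i => (hf i).2, fun ij _ => ?_, fun i j hij => ?_⟩
    · rw [Finset.mul_sum]
      refine Finset.sum_congr rfl fun m _ => ?_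
      simp only [Pi.add_apply, Pi.smul_apply, smul_eq_mul]
      ring
    · have hne : (f i : Fin d → F) ≠ f j := fun h => hij.ne (f.injective (Subtype.ext h))
      exact ⟨hne, fun h => hne (smul_right_injective _ hs (add_right_cancel h))⟩
  · rintro ⟨z, f⟩ - ⟨z', f'⟩ - h
    simp only [Prod.mk.injEq] at h
    have hx (i) : (f i : Fin d → F) = f' i := congrFun h.1 i
    obtain rfl : z = z' := by
      have h0 := congrFun h.2 0
      simp only [hx 0] at h0
      exact add_left_cancel h0
    obtain rfl : f = f' := by
      ext1 i
      exact Subtype.ext (hx i)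
    rfl

end

/-- For `r` a nonzero square,
`|S_A| ≥ |E|^{2k+2}/(2·q^{dk}) − (k² + k)^{k+1}·q^d/2` as real numbers. -/
theorem stmt_9 (p n : ℕ) (hp : p.Prime) (hp2 : p ≠ 2) (hn : 0 < n)
    (F : Type) [Field F] [Fintype F] [DecidableEq F] (hq : Fintype.card F = p ^ n)
    (d k : ℕ) (hd : 1 ≤ d) (hk : 1 ≤ k)
    (E : Finset (Fin d → F)) (r : F) (hr : ∃ s : F, s ≠ 0 ∧ r = s ^ 2)
    (A : Finset (Fin (k + 1) × Fin (k + 1))) (hAlt : ∀ ij ∈ A, ij.1 < ij.2) :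
    (E.card : ℝ) ^ (2 * k + 2) / (2 * (Fintype.card F : ℝ) ^ (d * k))
        - ((k : ℝ) ^ 2 + k) ^ (k + 1) * (Fintype.card F : ℝ) ^ d / 2
      ≤ ((SAset k E r A).card : ℝ) := by
  obtain ⟨s, hs, rfl⟩ := hr
  have hcount : (∑ z, ((similarityFiber E s z).card.descFactorial (k + 1) : ℝ))
      ≤ ((SAset k E (s ^ 2) A).card : ℝ) := by
    exact_mod_cast sum_descFactorial_le_card_SAset k E hs A
  have hpow : ∑ z, ((similarityFiber E s z).card : ℝ) ^ (k + 1)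
      ≤ ∑ z, (2 * ((similarityFiber E s z).card.descFactorial (k + 1) : ℝ)
        + ((k : ℝ) ^ 2 + k) ^ (k + 1)) :=
    Finset.sum_le_sum fun z _ => by
      exact_mod_cast pow_succ_le_two_mul_descFactorial_add (similarityFiber E s z).card k
  rw [Finset.sum_add_distrib, ← Finset.mul_sum, Finset.sum_const, nsmul_eq_mul,
    Finset.card_univ, Fintype.card_fun, Fintype.card_fin, Nat.cast_pow] at hpow
  have hmean := pow_sum_div_card_le_sum_pow (s := (Finset.univ : Finset (Fin d → F)))
    (f := fun z => ((similarityFiber E s z).card : ℝ)) (n := k) (fun _ _ => by positivity)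
  have hsum : ∑ z, ((similarityFiber E s z).card : ℝ) = (E.card : ℝ) ^ 2 := by
    exact_mod_cast sum_card_similarityFiber E s
  rw [hsum, Finset.card_univ, Fintype.card_fun, Fintype.card_fin, Nat.cast_pow, ← pow_mul,
    ← pow_mul] at hmean
  rw [show 2 * k + 2 = 2 * (k + 1) by ring, mul_comm (2 : ℝ), ← div_div]
  linarith
end

section
/- Let q be a power of an odd prime, d ≥ 1, k ≥ 1, and let E ⊆ F_q^d satisfy |E| ≥ (k+3)·q^{d/2} (as real numbers). Then there exists c ∈ F_q^d with c ≠ 0 such that |E ∩ (c + E)| ≥ k+1; consequently there exist pairwise distinct x_1,…,x_{k+1} ∈ E such that, setting y_i := x_i − c, one has y_i ∈ E for all i, y_i ≠ y_j and x_i ≠ x_j for i ≠ j, x_i ≠ y_i for all i, and ‖y_i − y_j‖ = ‖x_i − x_j‖ for all 1 ≤ i < j ≤ k+1. -/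
open Finset

/-- If `k * |G| < |E| (|E| - 1)`, some nonzero translate of `E` meets `E` in more than `k`
points. -/
theorem exists_ne_zero_lt_card_inter_translate {G : Type*} [AddCommGroup G] [Fintype G]
    [DecidableEq G] (E : Finset G) (k : ℕ) (h : Fintype.card G * k < E.offDiag.card) :
    ∃ c : G, c ≠ 0 ∧ k < (E ∩ E.image (fun x => c + x)).card := by
  obtain ⟨c, -, hc⟩ := Finset.exists_lt_card_fiber_of_mul_lt_card_of_maps_to
    (s := E.offDiag) (t := (Finset.univ : Finset G)) (f := fun a => a.1 - a.2) (n := k)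
    (fun _ _ => Finset.mem_univ _) (by simpa using h)
  refine ⟨c, ?_, hc.trans_le ?_⟩
  · rintro rfl
    obtain ⟨a, ha⟩ := Finset.card_pos.mp (Nat.zero_lt_of_lt hc)
    rw [Finset.mem_filter, Finset.mem_offDiag] at ha
    exact ha.1.2.2 (sub_eq_zero.mp ha.2)
  · refine Finset.card_le_card_of_injOn Prod.fst ?_ ?_
    · intro a ha
      simp only [Finset.coe_filter, Set.mem_ofPred_eq, Finset.mem_offDiag] at ha
      simp only [Finset.coe_inter, Set.mem_inter_iff, Finset.mem_coe, Finset.mem_image]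
      exact ⟨ha.1.1, a.2, ha.1.2.1, by rw [← ha.2]; abel⟩
    · intro a ha b hb hab
      simp only [Finset.coe_filter, Set.mem_ofPred_eq] at ha hb
      refine Prod.ext hab ?_
      have hsub := ha.2.trans hb.2.symm
      rwa [hab, sub_right_inj] at hsub

/-- If `|E| ≥ (k+3)·q^{d/2}` then there is `c ≠ 0` with
`|E ∩ (c + E)| ≥ k + 1`; consequently there are pairwise distinct `x₁,…,x_{k+1} ∈ E` such that
`y_i := x_i − c ∈ E`, the `y_i` are pairwise distinct, `x_i ≠ y_i`, and
`‖y_i − y_j‖ = ‖x_i − x_j‖` for all `i < j`. -/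
theorem stmt_10 (p n : ℕ) (hp : p.Prime) (hp2 : p ≠ 2) (hn : 0 < n)
    (F : Type) [Field F] [Fintype F] [DecidableEq F] (hq : Fintype.card F = p ^ n)
    (d k : ℕ) (hd : 1 ≤ d) (hk : 1 ≤ k)
    (E : Finset (Fin d → F))
    (hE : ((k : ℝ) + 3) * (Fintype.card F : ℝ) ^ ((d : ℝ) / 2) ≤ (E.card : ℝ)) :
    ∃ c : Fin d → F, c ≠ 0 ∧ k + 1 ≤ (E ∩ E.image (fun x => c + x)).card ∧
      ∃ x : Fin (k + 1) → (Fin d → F),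
        Function.Injective x ∧ (∀ i, x i ∈ E) ∧ (∀ i, x i - c ∈ E) ∧
        (∀ i j : Fin (k + 1), i ≠ j → x i - c ≠ x j - c) ∧
        (∀ i, x i ≠ x i - c) ∧
        ∀ i j : Fin (k + 1), i < j →
          ∑ m, ((x i - c) m - (x j - c) m) ^ 2 = ∑ m, (x i m - x j m) ^ 2 := by
  have key : Fintype.card (Fin d → F) * k < E.offDiag.card := by
    set s : ℝ := (Fintype.card F : ℝ) ^ ((d : ℝ) / 2) with hs
    have hs1 : 1 ≤ s := Real.one_le_rpow (by exact_mod_cast Fintype.card_pos) (by positivity)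
    have hs2 : s * s = (Fintype.card F : ℝ) ^ d := by
      rw [hs, ← Real.rpow_add (by exact_mod_cast Fintype.card_pos), add_halves,
        Real.rpow_natCast]
    have hk0 : (0 : ℝ) ≤ k := k.cast_nonneg
    have hpred : ((k : ℝ) + 2) * s ≤ (E.card : ℝ) - 1 := by linarith
    have hmul : (((k : ℝ) + 3) * s) * (((k : ℝ) + 2) * s) ≤ E.card * ((E.card : ℝ) - 1) :=
      mul_le_mul hE hpred (by positivity) (by positivity)
    have hcard : Fintype.card (Fin d → F) = Fintype.card F ^ d := by simp
    rw [Finset.offDiag_card, hcard, ← @Nat.cast_lt ℝ, Nat.cast_sub (Nat.le_mul_self _)]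
    push_cast
    rw [← hs2]
    nlinarith [mul_nonneg hk0 hk0, mul_pos (zero_lt_one.trans_le hs1) (zero_lt_one.trans_le hs1),
      mul_nonneg hk0 (mul_self_nonneg s), mul_nonneg (mul_nonneg hk0 hk0) (mul_self_nonneg s)]
  obtain ⟨c, hc, hlt⟩ := exists_ne_zero_lt_card_inter_translate E k key
  refine ⟨c, hc, hlt, ?_⟩
  obtain ⟨T, hTE, hT⟩ := Finset.exists_subset_card_eq (Nat.succ_le_of_lt hlt)
  let e := T.equivFinOfCardEq hT
  have hx : ∀ i, (e.symm i : Fin d → F) ∈ E ∩ E.image (fun x => c + x) :=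
    fun i => hTE (e.symm i).2
  have hinj : Function.Injective fun i => (e.symm i : Fin d → F) :=
    Subtype.val_injective.comp e.symm.injective
  refine ⟨fun i => e.symm i, hinj, fun i => (Finset.mem_inter.mp (hx i)).1, fun i => ?_,
    fun i j hij h => hij (hinj (sub_left_injective h)), fun i h => hc ?_, fun i j _ => ?_⟩
  · obtain ⟨y, hy, hyx⟩ := Finset.mem_image.mp (Finset.mem_inter.mp (hx i)).2
    simpa [← hyx] using hy
  · exact sub_eq_self.mp h.symm
  · simp
end

section
/- Let q be a power of an odd prime, d ≥ 1, k ≥ 1, let t ∈ F_q with t ≠ 0, and let E ⊆ F_q^d satisfy |E| ≥ √(k+2)·q^{d/2} (as real numbers, equivalently |E|² ≥ (k+2)·q^d). Then there exists a ∈ F_q^d such that |tE ∩ (E + a)| ≥ k+2. -/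
open Finset

/-- If `n * |G| ≤ |A| * |B|`, then some translate of `B` meets `A` in at least `n` points. -/
theorem exists_le_card_inter_image_add_right {G : Type*} [AddGroup G] [Fintype G] [DecidableEq G]
    (A B : Finset G) (n : ℕ) (h : Fintype.card G * n ≤ A.card * B.card) :
    ∃ a : G, n ≤ (A ∩ B.image fun x => x + a).card := by
  obtain ⟨a, -, ha⟩ := Finset.exists_le_card_fiber_of_mul_le_card_of_maps_to
    (s := A ×ˢ B) (t := Finset.univ) (f := fun z => -z.2 + z.1) (n := n)
    (fun _ _ => Finset.mem_univ _) Finset.univ_nonempty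
    (by rwa [Finset.card_univ, Finset.card_product])
  refine ⟨a, ha.trans (Finset.card_le_card_of_injOn Prod.fst ?_ ?_)⟩
  · rintro ⟨x, y⟩ hz
    obtain ⟨hxy, rfl⟩ := Finset.mem_filter.mp hz
    obtain ⟨hx, hy⟩ := Finset.mem_product.mp hxy
    exact Finset.mem_inter.mpr ⟨hx, Finset.mem_image.mpr ⟨y, hy, add_neg_cancel_left y x⟩⟩
  · rintro ⟨x, y⟩ hz ⟨x', y'⟩ hz' (rfl : x = x')
    have h : -y + x = -y' + x :=
      (Finset.mem_filter.mp hz).2.trans (Finset.mem_filter.mp hz').2.symm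
    rw [neg_injective (add_right_cancel h)]

/-- If `t ≠ 0` and `|E|² ≥ (k+2)·q^d` (equivalently
`|E| ≥ √(k+2)·q^{d/2}`), then there exists `a` with `|tE ∩ (E + a)| ≥ k + 2`. -/
theorem stmt_13 (p n : ℕ) (hp : p.Prime) (hp2 : p ≠ 2) (hn : 0 < n)
    (F : Type) [Field F] [Fintype F] [DecidableEq F] (hq : Fintype.card F = p ^ n)
    (d k : ℕ) (hd : 1 ≤ d) (hk : 1 ≤ k)
    (E : Finset (Fin d → F)) (t : F) (ht : t ≠ 0)
    (hE : ((k : ℝ) + 2) * (Fintype.card F : ℝ) ^ d ≤ (E.card : ℝ) ^ 2) :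
    ∃ a : Fin d → F,
      k + 2 ≤ ((E.image fun x => t • x) ∩ (E.image fun x => x + a)).card := by
  apply exists_le_card_inter_image_add_right
  rw [Finset.card_image_of_injective E (smul_right_injective _ ht), Fintype.card_fun,
    Fintype.card_fin, mul_comm, ← sq]
  exact_mod_cast hE
end

section
/- Let q be a power of an odd prime, d ≥ 1, k ≥ 1, let r ∈ F_q be a nonzero square with r ≠ 1, and let E ⊆ F_q^d satisfy |E| ≥ √(k+2)·q^{d/2} (as real numbers, equivalently |E|² ≥ (k+2)·q^d). Then there exist (y_1,…,y_{k+1}) ∈ E^{k+1} and (z_1,…,z_{k+1}) ∈ E^{k+1} such that y_i ≠ y_j and z_i ≠ z_j whenever 1 ≤ i < j ≤ k+1, y_i ≠ z_i for every i ∈ {1,…,k+1}, and ‖y_i − y_j‖ = r·‖z_i − z_j‖ for all 1 ≤ i < j ≤ k+1. -/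
open Finset

/-- Let `r` be a nonzero square with `r ≠ 1` and let `E ⊆ F_q^d` satisfy
`|E|² ≥ (k+2)·q^d` (equivalently `|E| ≥ √(k+2)·q^{d/2}`). Then there are tuples
`y, z : Fin (k+1) → F_q^d` of points of `E`, each with pairwise distinct entries, with
`y_i ≠ z_i` for every `i`, and `‖y_i − y_j‖ = r·‖z_i − z_j‖` for all `i < j`. -/
theorem stmt_15 (p n : ℕ) (hp : p.Prime) (hp2 : p ≠ 2) (hn : 0 < n)
    (F : Type) [Field F] [Fintype F] [DecidableEq F] (hq : Fintype.card F = p ^ n)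
    (d k : ℕ) (hd : 1 ≤ d) (hk : 1 ≤ k)
    (r : F) (hr : ∃ s : F, s ≠ 0 ∧ r = s ^ 2) (hr1 : r ≠ 1)
    (E : Finset (Fin d → F))
    (hE : ((k : ℝ) + 2) * (Fintype.card F : ℝ) ^ d ≤ (E.card : ℝ) ^ 2) :
    ∃ y z : Fin (k + 1) → (Fin d → F),
      (∀ i, y i ∈ E) ∧ (∀ i, z i ∈ E) ∧
      (∀ i j : Fin (k + 1), i < j → y i ≠ y j ∧ z i ≠ z j) ∧
      (∀ i, y i ≠ z i) ∧
      (∀ i j : Fin (k + 1), i < j →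
        ∑ m', (y i m' - y j m') ^ 2 = r * ∑ m', (z i m' - z j m') ^ 2) := by
  obtain ⟨s, hs0, rfl⟩ := hr
  have hs1 : s ≠ 1 := by rintro rfl; simp at hr1
  have hcard : (univ : Finset (Fin d → F)).card * (k + 2) ≤ (E ×ˢ E).card := by
    rw [card_product, card_univ, Fintype.card_fun, Fintype.card_fin]
    have h : (k + 2) * Fintype.card F ^ d ≤ E.card ^ 2 := by exact_mod_cast hE
    linarith
  obtain ⟨t, -, ht⟩ := exists_le_card_fiber_of_mul_le_card_of_maps_to
    (f := fun a : (Fin d → F) × (Fin d → F) => a.2 - s • a.1)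
    (fun _ _ => mem_univ _) univ_nonempty hcard
  set S := (E ×ˢ E).filter (fun a => a.2 - s • a.1 = t) with hS
  have hfix : (S.filter (fun a => ¬ a.1 ≠ a.2)).card ≤ 1 := by
    refine card_le_one.2 fun a ha b hb => ?_
    simp only [hS, mem_filter, not_not] at ha hb
    obtain ⟨⟨-, ha⟩, ha'⟩ := ha
    obtain ⟨⟨-, hb⟩, hb'⟩ := hb
    have h : a.1 = b.1 := by
      funext m
      have h1 := congrFun (ha.trans hb.symm) m
      rw [← ha', ← hb'] at h1
      simp only [Pi.sub_apply, Pi.smul_apply, smul_eq_mul] at h1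
      apply mul_left_cancel₀ (sub_ne_zero.2 hs1.symm)
      linear_combination h1
    exact Prod.ext h (by rw [← ha', ← hb', h])
  have hsplit := card_filter_add_card_filter_not (s := S) (fun a => a.1 ≠ a.2)
  obtain ⟨T, hTS, hT⟩ := exists_subset_card_eq
    (show k + 1 ≤ (S.filter (fun a => a.1 ≠ a.2)).card by omega)
  let e := T.equivFinOfCardEq hT
  have he (i : Fin (k + 1)) : (((e.symm i).1.1 ∈ E ∧ (e.symm i).1.2 ∈ E) ∧
      (e.symm i).1.2 - s • (e.symm i).1.1 = t) ∧ (e.symm i).1.1 ≠ (e.symm i).1.2 := by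
    simpa only [hS, mem_filter, mem_product] using hTS (e.symm i).2
  have hy (i : Fin (k + 1)) (m : Fin d) :
      (e.symm i).1.2 m = t m + s * (e.symm i).1.1 m := by
    rw [← (he i).1.2]
    simp
  have hz {i j : Fin (k + 1)} (h : (e.symm i).1.1 = (e.symm j).1.1) : i = j := by
    refine e.symm.injective (Subtype.ext (Prod.ext h (funext fun m => ?_)))
    rw [hy, hy, h]
  refine ⟨fun i => (e.symm i).1.2, fun i => (e.symm i).1.1, fun i => (he i).1.1.2,
    fun i => (he i).1.1.1, fun i j hij => ⟨fun h => hij.ne (hz (funext fun m => ?_)),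
      fun h => hij.ne (hz h)⟩, fun i => (he i).2.symm, fun i j _ => ?_⟩
  · have h1 := congrFun h m
    simp only [hy] at h1
    exact mul_left_cancel₀ hs0 (add_left_cancel h1)
  · rw [mul_sum]
    refine sum_congr rfl fun m _ => ?_
    simp only [hy]
    ring
end

section
/- Let p be a prime with p ≡ 3 (mod 4), let ℓ be an odd positive integer, let F be a finite field with p^{2ℓ} elements, and let K ⊆ F be its subfield with p^ℓ elements. Set E := K × K ⊆ F², so that |E| = p^{2ℓ}. Then there exists a nonzero square r ∈ F with r ∉ K, and for every such r the following holds: for all x, x', y, y' ∈ E with x ≠ x', one has ‖y − y'‖ ≠ r·‖x − x'‖, where ‖(α_1,α_2)‖ := α_1² + α_2². In particular, with q = p^{2ℓ} and d = 2, E is a subset of F_q² of size exactly q^{d/2} containing no pair of point configurations dilated by ratio r. -/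
open Finset

/-- Pairs of elements of a subset of `F`, viewed as functions on `Fin 2`. -/
def finTwoSubtypeEquiv {F : Type*} (K : Set F) :
    {x : Fin 2 → F // x 0 ∈ K ∧ x 1 ∈ K} ≃ K × K where
  toFun x := (⟨x.1 0, x.2.1⟩, ⟨x.1 1, x.2.2⟩)
  invFun y := ⟨![y.1, y.2], y.1.2, y.2.2⟩
  left_inv x := by
    ext i
    fin_cases i <;> rfl
  right_inv _ := rfl

theorem Odd.pow_mod_four_eq_three {p ℓ : ℕ} (hp : p % 4 = 3) (hℓ : Odd ℓ) : p ^ ℓ % 4 = 3 := by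
  obtain ⟨k, rfl⟩ := hℓ
  rw [pow_succ, pow_mul, Nat.mul_mod, Nat.pow_mod, Nat.pow_mod p 2, hp]
  norm_num

theorem eq_zero_of_sq_add_sq_eq_zero {K : Type*} [Field K] (h : ¬IsSquare (-1 : K)) {a b : K}
    (hab : a ^ 2 + b ^ 2 = 0) : b = 0 := by
  by_contra hb
  refine h ⟨a / b, ?_⟩
  field_simp
  linear_combination -hab

theorem Subfield.eq_top_of_forall_sq_mem {F : Type*} [Field F] (h2 : (2 : F) ≠ 0)
    {K : Subfield F} (h : ∀ s : F, s ^ 2 ∈ K) : K = ⊤ := by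
  refine eq_top_iff.2 fun x _ ↦ ?_
  have hx : x = ((x + 1) ^ 2 - x ^ 2 - 1) / 2 := by
    field_simp
    ring
  rw [hx]
  exact K.div_mem (K.sub_mem (K.sub_mem (h _) (h _)) K.one_mem) (ofNat_mem K 2)

/-- Let `p ≡ 3 (mod 4)` be prime, `ℓ` odd, `F` a field with `p^{2ℓ}` elements
and `K ⊆ F` its subfield with `p^ℓ` elements. Then `E := K × K ⊆ F²` has exactly `p^{2ℓ}`
elements, there exists a nonzero square `r ∈ F` with `r ∉ K`, and for every such `r`, no pair of
points `y, y'` of `E` is dilated by ratio `r` with respect to a pair of distinct points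
`x, x'` of `E`. -/
theorem stmt_16 (p ℓ : ℕ) (hp : p.Prime) (hp4 : p % 4 = 3) (hℓ : Odd ℓ) (hℓpos : 0 < ℓ)
    (F : Type) [Field F] [Fintype F] (hF : Fintype.card F = p ^ (2 * ℓ))
    (K : Subfield F) (hK : Nat.card K = p ^ ℓ) :
    Nat.card {x : Fin 2 → F // x 0 ∈ K ∧ x 1 ∈ K} = p ^ (2 * ℓ) ∧
    (∃ r : F, (∃ s : F, s ≠ 0 ∧ r = s ^ 2) ∧ r ∉ K) ∧
    ∀ r : F, (∃ s : F, s ≠ 0 ∧ r = s ^ 2) → r ∉ K →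
      ∀ x x' y y' : Fin 2 → F,
        x 0 ∈ K → x 1 ∈ K → x' 0 ∈ K → x' 1 ∈ K →
        y 0 ∈ K → y 1 ∈ K → y' 0 ∈ K → y' 1 ∈ K →
        x ≠ x' →
        ∑ m, (y m - y' m) ^ 2 ≠ r * ∑ m, (x m - x' m) ^ 2 := by
  have hns : ¬IsSquare (-1 : K) := by
    have : Fintype K := Fintype.ofFinite K
    rw [FiniteField.isSquare_neg_one_iff, not_not, ← Nat.card_eq_fintype_card, hK]
    exact hℓ.pow_mod_four_eq_three hp4
  have h2 : (2 : F) ≠ 0 := fun h ↦ hns ⟨1, Subtype.ext <| by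
    push_cast
    linear_combination -h⟩
  refine ⟨?_, ?_, ?_⟩
  · refine (Nat.card_congr (finTwoSubtypeEquiv (K : Set F))).trans ?_
    rw [Nat.card_prod]
    change Nat.card K * Nat.card K = _
    rw [hK, ← pow_add, two_mul]
  · by_contra! h
    have htop : K = ⊤ := Subfield.eq_top_of_forall_sq_mem h2 fun s ↦ by
      rcases eq_or_ne s 0 with rfl | hs
      · simp
      · exact h _ ⟨s, hs, rfl⟩
    have hcard : p ^ ℓ = p ^ (2 * ℓ) := by
      rw [← hK, ← hF, htop, ← Nat.card_eq_fintype_card]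
      exact Nat.card_congr Subfield.topEquiv.toEquiv
    have := Nat.pow_right_injective hp.two_le hcard
    omega
  · intro r _ hr x x' y y' hx0 hx1 hx0' hx1' hy0 hy1 hy0' hy1' hxx' heq
    simp only [Fin.sum_univ_two] at heq
    have hN : (x 0 - x' 0) ^ 2 + (x 1 - x' 1) ^ 2 ≠ 0 := by
      intro h0
      let a : K := ⟨x 0 - x' 0, K.sub_mem hx0 hx0'⟩
      let b : K := ⟨x 1 - x' 1, K.sub_mem hx1 hx1'⟩
      have hab : a ^ 2 + b ^ 2 = 0 := Subtype.ext h0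
      have hb := congrArg Subtype.val (eq_zero_of_sq_add_sq_eq_zero hns hab)
      have ha := congrArg Subtype.val (eq_zero_of_sq_add_sq_eq_zero hns ((add_comm _ _).trans hab))
      refine hxx' (funext fun i ↦ ?_)
      fin_cases i
      · exact sub_eq_zero.1 ha
      · exact sub_eq_zero.1 hb
    apply hr
    rw [eq_div_of_mul_eq hN heq.symm]
    have hsq {a b : F} (ha : a ∈ K) (hb : b ∈ K) : (a - b) ^ 2 ∈ K := K.pow_mem (K.sub_mem ha hb) 2
    exact K.div_mem (K.add_mem (hsq hy0 hy0') (hsq hy1 hy1'))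
      (K.add_mem (hsq hx0 hx0') (hsq hx1 hx1'))
end

section
/- Let q be a power of an odd prime with q ≡ 3 (mod 4). For a ∈ F_q² and R ∈ F_q, let S(a;R) := {x ∈ F_q² : ‖x − a‖ = R}. If (a,R) ≠ (b,S) (i.e., the two spheres are distinct as center–radius pairs), then |S(a;R) ∩ S(b;S)| ≤ 2. -/
open Finset

/-- If `-1` is not a square, the form `u ^ 2 + v ^ 2` is anisotropic. -/
lemma sq_add_sq_ne_zero_of_not_isSquare_neg_one {F : Type*} [Field F]
    (hF : ¬ IsSquare (-1 : F)) {u v : F} (h : ¬ (u = 0 ∧ v = 0)) : u ^ 2 + v ^ 2 ≠ 0 := by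
  intro h0
  by_cases hv : v = 0
  · subst hv
    exact h ⟨by simpa using h0, rfl⟩
  · refine hF ⟨u / v, ?_⟩
    field_simp
    linear_combination -h0

/-- Among the common points of two circles with distinct centers, a point is determined by its
coordinate along the radical axis. -/
lemma eq_of_mem_circles_of_axis_coord_eq {F : Type*} [Field F] (h2 : (2 : F) ≠ 0)
    {a b x y : Fin 2 → F} {R S : F}
    (hN : (b 0 - a 0) ^ 2 + (b 1 - a 1) ^ 2 ≠ 0)
    (hx : (x 0 - a 0) ^ 2 + (x 1 - a 1) ^ 2 = R) (hx' : (x 0 - b 0) ^ 2 + (x 1 - b 1) ^ 2 = S)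
    (hy : (y 0 - a 0) ^ 2 + (y 1 - a 1) ^ 2 = R) (hy' : (y 0 - b 0) ^ 2 + (y 1 - b 1) ^ 2 = S)
    (h : (b 0 - a 0) * (x 1 - a 1) - (b 1 - a 1) * (x 0 - a 0) =
      (b 0 - a 0) * (y 1 - a 1) - (b 1 - a 1) * (y 0 - a 0)) : x = y := by
  have hdot : (b 0 - a 0) * (x 0 - y 0) + (b 1 - a 1) * (x 1 - y 1) = 0 := by
    apply mul_left_cancel₀ h2
    linear_combination hx - hx' - hy + hy'
  have e0 : x 0 = y 0 := by
    apply mul_left_cancel₀ hN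
    linear_combination (b 0 - a 0) * hdot - (b 1 - a 1) * h
  have e1 : x 1 = y 1 := by
    apply mul_left_cancel₀ hN
    linear_combination (b 1 - a 1) * hdot + (b 0 - a 0) * h
  ext i
  fin_cases i
  exacts [e0, e1]

/-- The coordinates along the radical axis of two common points of two circles agree up to sign. -/
lemma axis_coord_eq_or_eq_neg_of_mem_circles {F : Type*} [Field F] (h2 : (2 : F) ≠ 0)
    {a b x y : Fin 2 → F} {R S : F}
    (hx : (x 0 - a 0) ^ 2 + (x 1 - a 1) ^ 2 = R) (hx' : (x 0 - b 0) ^ 2 + (x 1 - b 1) ^ 2 = S)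
    (hy : (y 0 - a 0) ^ 2 + (y 1 - a 1) ^ 2 = R) (hy' : (y 0 - b 0) ^ 2 + (y 1 - b 1) ^ 2 = S) :
    (b 0 - a 0) * (x 1 - a 1) - (b 1 - a 1) * (x 0 - a 0) =
      (b 0 - a 0) * (y 1 - a 1) - (b 1 - a 1) * (y 0 - a 0) ∨
    (b 0 - a 0) * (x 1 - a 1) - (b 1 - a 1) * (x 0 - a 0) =
      -((b 0 - a 0) * (y 1 - a 1) - (b 1 - a 1) * (y 0 - a 0)) := by
  rw [← sq_eq_sq_iff_eq_or_eq_neg]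
  have hdot : (b 0 - a 0) * (x 0 - y 0) + (b 1 - a 1) * (x 1 - y 1) = 0 := by
    apply mul_left_cancel₀ h2
    linear_combination hx - hx' - hy + hy'
  linear_combination ((b 0 - a 0) ^ 2 + (b 1 - a 1) ^ 2) * (hx - hy) -
    ((b 0 - a 0) * (x 0 - a 0) + (b 1 - a 1) * (x 1 - a 1) +
      (b 0 - a 0) * (y 0 - a 0) + (b 1 - a 1) * (y 1 - a 1)) * hdot

/-- Let `q ≡ 3 (mod 4)` be a power of an odd prime. Two distinct spheres
`S(a;R)` and `S(b;S)` in `F_q²` (distinct as center–radius pairs) intersect in at most two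
points. -/
theorem stmt_19 (p n : ℕ) (hp : p.Prime) (hp2 : p ≠ 2) (hn : 0 < n)
    (F : Type) [Field F] [Fintype F] [DecidableEq F] (hq : Fintype.card F = p ^ n)
    (h4 : Fintype.card F % 4 = 3)
    (a b : Fin 2 → F) (R S : F) (hdist : (a, R) ≠ (b, S)) :
    (Finset.univ.filter fun x : Fin 2 → F =>
        ∑ m, (x m - a m) ^ 2 = R ∧ ∑ m, (x m - b m) ^ 2 = S).card ≤ 2 := by
  have hF : ¬ IsSquare (-1 : F) := fun h => FiniteField.isSquare_neg_one_iff.mp h h4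
  have h2 : (2 : F) ≠ 0 := fun h => hF ⟨1, by linear_combination -h⟩
  by_contra! hcard
  obtain ⟨x, y, z, hx, hy, hz, hxy, hxz, hyz⟩ := Finset.two_lt_card_iff.mp hcard
  simp only [mem_filter, mem_univ, true_and, Fin.sum_univ_two] at hx hy hz
  obtain ⟨hx, hx'⟩ := hx
  obtain ⟨hy, hy'⟩ := hy
  obtain ⟨hz, hz'⟩ := hz
  have hN : (b 0 - a 0) ^ 2 + (b 1 - a 1) ^ 2 ≠ 0 := by
    refine sq_add_sq_ne_zero_of_not_isSquare_neg_one hF fun ⟨h0, h1⟩ => hdist ?_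
    have hab : a = b := by
      ext i
      fin_cases i
      exacts [(sub_eq_zero.mp h0).symm, (sub_eq_zero.mp h1).symm]
    subst hab
    rw [← hx, ← hx']
  rcases axis_coord_eq_or_eq_neg_of_mem_circles h2 hx hx' hy hy' with h | h
  · exact hxy (eq_of_mem_circles_of_axis_coord_eq h2 hN hx hx' hy hy' h)
  rcases axis_coord_eq_or_eq_neg_of_mem_circles h2 hx hx' hz hz' with h' | h'
  · exact hxz (eq_of_mem_circles_of_axis_coord_eq h2 hN hx hx' hz hz' h')
  · exact hyz (eq_of_mem_circles_of_axis_coord_eq h2 hN hy hy' hz hz'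
      (neg_injective (h.symm.trans h')))
end
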